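/- Let Ω_N = {0,1}^N with the uniform probability measure, let Gₙ be the current run of heads process and R_N the longest run of heads. Assume there exist constants C > 0 and N₀ such that for all N ≥ N₀, |E(R_N) − log₂ N| ≤ C and Var(R_N) ≤ 4. Then liminf_{N→∞} ( max_{1≤k≤N} k · P(R_N ≥ k) ) / log₂ N ≥ 1; in particular, there exist stopping times τ_N on Ω_N (with respect to the natural filtration) such that E[ 1_{τ_N ≤ N} · G_{τ_N} ] / log₂ N → 1 is bounded below in the limit by 1. -/

import Mathlib

open MeasureTheory
open scoped ENNReal

/-- The current run of heads at time `n` (0-indexed coordinates; `true` = heads):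
the largest `r ≤ n` such that coordinates `n - r, …, n - 1` are all heads. -/
noncomputable def runG (N : ℕ) (ω : Fin N → Bool) (n : ℕ) : ℕ :=
  sSup {r : ℕ | r ≤ n ∧ ∀ i : Fin N, n - r ≤ (i : ℕ) → (i : ℕ) < n → ω i = true}

/-- The longest run of heads: `R_N = max_{0 ≤ n ≤ N} G_n`. -/
noncomputable def runR (N : ℕ) (ω : Fin N → Bool) : ℕ :=
  (Finset.range (N + 1)).sup (runG N ω)

/-- The natural filtration on `{0,1}^N`: `F n` is generated by the first `n`
coordinates. -/
def coordFiltration (N : ℕ) (n : ℕ) : MeasurableSpace (Fin N → Bool) :=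
  MeasurableSpace.comap
    (fun ω => (fun i : {i : Fin N // (i : ℕ) < n} => ω i.1)) inferInstance

/-- `E(R_N)` under the uniform measure on `{0,1}^N`. -/
noncomputable def meanR (N : ℕ) : ℝ :=
  (∑ ω : Fin N → Bool, (runR N ω : ℝ)) / 2 ^ N

/-- `Var(R_N)` under the uniform measure on `{0,1}^N`. -/
noncomputable def varR (N : ℕ) : ℝ :=
  (∑ ω : Fin N → Bool, ((runR N ω : ℝ) - meanR N) ^ 2) / 2 ^ N

/-- `P(R_N ≥ k)` under the uniform measure on `{0,1}^N`. -/
noncomputable def prR (N : ℕ) (k : ℕ) : ℝ :=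
  ((Finset.univ.filter fun ω : Fin N → Bool => k ≤ runR N ω).card : ℝ) / 2 ^ N
open Filter Topology

lemma runG_congr {N n : ℕ} {ω ω' : Fin N → Bool}
    (h : ∀ i : Fin N, (i : ℕ) < n → ω i = ω' i) : runG N ω n = runG N ω' n := by
  unfold runG
  congr 1
  ext r
  refine and_congr_right fun _ => forall_congr' fun i => ?_
  refine forall_congr' fun _ => forall_congr' fun hi => ?_
  rw [h i hi]

lemma runG_le_runR {N n : ℕ} (hn : n ≤ N) (ω : Fin N → Bool) : runG N ω n ≤ runR N ω :=
  Finset.le_sup (f := runG N ω) (Finset.mem_range.2 (Nat.lt_succ_of_le hn))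

lemma le_runR_iff {N k : ℕ} {ω : Fin N → Bool} :
    k ≤ runR N ω ↔ ∃ n, n ≤ N ∧ k ≤ runG N ω n := by
  refine ⟨fun h => ?_, fun ⟨n, hn, hk⟩ => hk.trans (runG_le_runR hn ω)⟩
  obtain ⟨n, hn, heq⟩ := Finset.exists_mem_eq_sup (Finset.range (N + 1)) (by simp) (runG N ω)
  exact ⟨n, by simpa [Nat.lt_succ_iff] using hn, by rw [← heq]; exact h⟩

open Classical in
/-- The first time `n ≤ N` at which the current run of heads has length at least `k`. -/
noncomputable def firstRun (k N : ℕ) (ω : Fin N → Bool) : ℕ∞ :=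
  if h : ∃ n, n ≤ N ∧ k ≤ runG N ω n then (Nat.find h : ℕ∞) else ⊤

lemma firstRun_le_iff {k N n : ℕ} {ω : Fin N → Bool} :
    firstRun k N ω ≤ (n : ℕ∞) ↔ ∃ m ≤ n, m ≤ N ∧ k ≤ runG N ω m := by
  classical
  unfold firstRun
  split_ifs with h
  · rw [Nat.cast_le, Nat.find_le_iff]
  · simp only [top_le_iff, ENat.natCast_ne_top, false_iff]
    exact fun ⟨m, _, hm⟩ => h ⟨m, hm⟩

lemma firstRun_le_iff_le_runR {k N : ℕ} {ω : Fin N → Bool} :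
    firstRun k N ω ≤ (N : ℕ∞) ↔ k ≤ runR N ω := by
  rw [firstRun_le_iff, le_runR_iff]
  exact exists_congr fun m => by tauto

lemma le_runG_firstRun {k N : ℕ} {ω : Fin N → Bool} (h : firstRun k N ω ≤ (N : ℕ∞)) :
    k ≤ runG N ω (firstRun k N ω).toNat := by
  classical
  have h' : ∃ n, n ≤ N ∧ k ≤ runG N ω n := le_runR_iff.1 (firstRun_le_iff_le_runR.1 h)
  have heq : firstRun k N ω = (Nat.find h' : ℕ∞) := dif_pos h'
  rw [heq, ENat.toNat_natCast]
  exact (Nat.find_spec h').2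

lemma measurableSet_coordFiltration {N n : ℕ} {s : Set (Fin N → Bool)}
    (h : ∀ ω ω' : Fin N → Bool, (∀ i : Fin N, (i : ℕ) < n → ω i = ω' i) → ω ∈ s → ω' ∈ s) :
    MeasurableSet[coordFiltration N n] s := by
  refine ⟨(fun ω => (fun i : {i : Fin N // (i : ℕ) < n} => ω i.1)) '' s,
    (Set.toFinite _).measurableSet, ?_⟩
  ext ω
  constructor
  · rintro ⟨ω', hω', heq⟩
    exact h ω' ω (fun i hi => congrFun heq ⟨i, hi⟩) hω'
  · exact fun hω => ⟨ω, hω, rfl⟩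

lemma measurableSet_firstRun_le (k N n : ℕ) :
    MeasurableSet[coordFiltration N n] {ω | firstRun k N ω ≤ (n : ℕ∞)} := by
  refine measurableSet_coordFiltration fun ω ω' hω => ?_
  simp only [Set.mem_ofPred_eq, firstRun_le_iff]
  rintro ⟨m, hmn, hm, hk⟩
  exact ⟨m, hmn, hm, hk.trans_eq (runG_congr fun i hi => hω i (hi.trans_le hmn))⟩

lemma prR_nonneg (N k : ℕ) : 0 ≤ prR N k := by
  unfold prR
  positivity

lemma meanR_nonneg (N : ℕ) : 0 ≤ meanR N := by
  unfold meanR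
  positivity

lemma mul_prR_eq (N k : ℕ) :
    (k : ℝ) * prR N k = (∑ ω : Fin N → Bool, if k ≤ runR N ω then (k : ℝ) else 0) / 2 ^ N := by
  rw [prR, ← Finset.sum_filter, Finset.sum_const, nsmul_eq_mul]
  ring

/-- Markov's inequality for the longest run. -/
lemma mul_prR_le_meanR (N k : ℕ) : (k : ℝ) * prR N k ≤ meanR N := by
  rw [mul_prR_eq, meanR]
  gcongr with ω
  split_ifs with h
  · exact_mod_cast h
  · positivity

/-- One-sided Chebyshev bound for the longest run. -/
lemma one_sub_varR_div_le_prR {N k : ℕ} {d : ℝ} (hd : 0 < d) (hk : k ≤ meanR N - d) :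
    1 - varR N / d ^ 2 ≤ prR N k := by
  have hcompl : prR N k = 1 -
      ((Finset.univ.filter fun ω : Fin N → Bool => ¬ k ≤ runR N ω).card : ℝ) / 2 ^ N := by
    have h := Finset.card_filter_add_card_filter_not (s := Finset.univ)
      (fun ω : Fin N → Bool => k ≤ runR N ω)
    rw [Finset.card_univ, Fintype.card_fun, Fintype.card_bool, Fintype.card_fin] at h
    have h' : ((Finset.univ.filter fun ω : Fin N → Bool => k ≤ runR N ω).card : ℝ) +
        ((Finset.univ.filter fun ω : Fin N → Bool => ¬ k ≤ runR N ω).card : ℝ) = 2 ^ N := by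
      exact_mod_cast h
    rw [prR, eq_sub_iff_add_eq, ← add_div, h', div_self (by positivity)]
  rw [hcompl, varR, div_right_comm]
  gcongr
  rw [le_div_iff₀ (by positivity), ← nsmul_eq_mul, ← Finset.sum_const, Finset.sum_filter]
  gcongr with ω
  split_ifs with h
  · positivity
  · have hlt : (runR N ω : ℝ) < k := by exact_mod_cast not_le.1 h
    nlinarith

lemma mul_prR_le_iSup {N k : ℕ} (hk : k ∈ Finset.Icc 1 N) :
    (k : ℝ) * prR N k ≤ ⨆ k ∈ Finset.Icc 1 N, (k : ℝ) * prR N k := by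
  refine le_ciSup_of_le ⟨meanR N, ?_⟩ k
    (ciSup_pos (f := fun _ => (k : ℝ) * prR N k) hk).ge
  rintro _ ⟨j, rfl⟩
  exact Real.iSup_le (fun _ => mul_prR_le_meanR N j) (meanR_nonneg N)

lemma iSup_mul_prR_le_meanR (N : ℕ) :
    ⨆ k ∈ Finset.Icc 1 N, (k : ℝ) * prR N k ≤ meanR N :=
  Real.iSup_le (fun k => Real.iSup_le (fun _ => mul_prR_le_meanR N k) (meanR_nonneg N))
    (meanR_nonneg N)

lemma mul_prR_le_firstRun_payoff (N k : ℕ) :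
    (k : ℝ) * prR N k ≤ (∑ ω : Fin N → Bool,
      if firstRun k N ω ≤ (N : ℕ∞) then (runG N ω (firstRun k N ω).toNat : ℝ) else 0) / 2 ^ N := by
  rw [mul_prR_eq]
  simp only [← firstRun_le_iff_le_runR]
  gcongr with ω
  split_ifs with h
  · exact_mod_cast le_runG_firstRun h
  · exact le_rfl

lemma payoff_le_meanR (N : ℕ) (τ : (Fin N → Bool) → ℕ∞) :
    (∑ ω : Fin N → Bool,
      if τ ω ≤ (N : ℕ∞) then (runG N ω (τ ω).toNat : ℝ) else 0) / 2 ^ N ≤ meanR N := by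
  rw [meanR]
  gcongr with ω
  split_ifs with h
  · exact_mod_cast runG_le_runR (ENat.toNat_le_of_le_natCast h) ω
  · positivity

lemma tendsto_logb_natCast_atTop : Tendsto (fun N : ℕ => Real.logb 2 N) atTop atTop :=
  (Real.tendsto_logb_atTop one_lt_two).comp tendsto_natCast_atTop_atTop

/-- The threshold `log₂ N - √(log₂ N)`, which lies far below `E(R_N)` compared with the standard
deviation of `R_N`, but is still asymptotic to `log₂ N`. -/
noncomputable def runThreshold (N : ℕ) : ℕ :=
  ⌈Real.logb 2 N - √(Real.logb 2 N)⌉₊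

lemma runThreshold_mem_Icc : ∀ᶠ N : ℕ in atTop, runThreshold N ∈ Finset.Icc 1 N := by
  filter_upwards [tendsto_logb_natCast_atTop.eventually_gt_atTop 1, eventually_gt_atTop 0]
    with N hL hN
  rw [Finset.mem_Icc]
  constructor
  · refine Nat.ceil_pos.2 (sub_pos.2 ?_)
    rw [Real.sqrt_lt' (by linarith)]
    nlinarith
  · refine Nat.ceil_le.2 ((sub_le_self _ (Real.sqrt_nonneg _)).trans ?_)
    rw [Real.logb_le_iff_le_rpow one_lt_two (by exact_mod_cast hN), Real.rpow_natCast]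
    exact_mod_cast Nat.lt_two_pow_self.le

lemma le_runThreshold_mul_prR_div {C : ℝ} {N₀ : ℕ}
    (hE : ∀ N : ℕ, N₀ ≤ N → |meanR N - Real.logb 2 N| ≤ C)
    (hV : ∀ N : ℕ, N₀ ≤ N → varR N ≤ 4) :
    ∀ᶠ N : ℕ in atTop,
      (1 - (√(Real.logb 2 N))⁻¹) * (1 - 4 / (√(Real.logb 2 N) - (C + 1)) ^ 2) ≤
        (runThreshold N : ℝ) * prR N (runThreshold N) / Real.logb 2 N := by
  have hsqrt := Real.tendsto_sqrt_atTop.comp tendsto_logb_natCast_atTop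
  filter_upwards [eventually_ge_atTop N₀, hsqrt.eventually_gt_atTop (C + 1),
    hsqrt.eventually_gt_atTop 1] with N hN hC hs
  simp only [Function.comp_apply] at hC hs
  have hL : 0 < Real.logb 2 N := Real.sqrt_pos.1 (by linarith)
  have hsq := Real.sq_sqrt hL.le
  have hk : Real.logb 2 N - √(Real.logb 2 N) ≤ runThreshold N := Nat.le_ceil _
  have hk' : (runThreshold N : ℝ) < Real.logb 2 N - √(Real.logb 2 N) + 1 :=
    Nat.ceil_lt_add_one (by nlinarith)
  have hd : 0 < √(Real.logb 2 N) - (C + 1) := by linarith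
  have hpr : 1 - 4 / (√(Real.logb 2 N) - (C + 1)) ^ 2 ≤ prR N (runThreshold N) := by
    refine le_trans ?_ (one_sub_varR_div_le_prR hd ?_)
    · gcongr
      exact hV N hN
    · linarith [(abs_le.1 (hE N hN)).1]
  have hone : 1 - (√(Real.logb 2 N))⁻¹ =
      (Real.logb 2 N - √(Real.logb 2 N)) / Real.logb 2 N := by
    rw [sub_div, div_self hL.ne', Real.sqrt_div_self]
  have hinv : (√(Real.logb 2 N))⁻¹ ≤ 1 := inv_le_one_of_one_le₀ hs.le
  calc _ ≤ (1 - (√(Real.logb 2 N))⁻¹) * prR N (runThreshold N) := by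
        gcongr
    _ ≤ (runThreshold N : ℝ) / Real.logb 2 N * prR N (runThreshold N) := by
        rw [hone]
        gcongr
        exact prR_nonneg _ _
    _ = _ := by ring

lemma tendsto_lower_envelope (C : ℝ) :
    Tendsto (fun N : ℕ =>
      (1 - (√(Real.logb 2 N))⁻¹) * (1 - 4 / (√(Real.logb 2 N) - (C + 1)) ^ 2)) atTop (𝓝 1) := by
  have hsqrt := Real.tendsto_sqrt_atTop.comp tendsto_logb_natCast_atTop
  have h₁ := (tendsto_inv_atTop_zero.comp hsqrt).const_sub 1
  have h₂ := (((tendsto_pow_atTop two_ne_zero).comp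
    (tendsto_atTop_add_const_right atTop (-(C + 1)) hsqrt)).const_div_atTop 4).const_sub 1
  simpa [sub_eq_add_neg] using h₁.mul h₂

/-- A sequence between `k_N P(R_N ≥ k_N)` and `E(R_N)`, with `k_N` the threshold `runThreshold N`,
is asymptotic to `log₂ N`. -/
lemma tendsto_div_logb_of_le_meanR {C : ℝ} {N₀ : ℕ}
    (hE : ∀ N : ℕ, N₀ ≤ N → |meanR N - Real.logb 2 N| ≤ C)
    (hV : ∀ N : ℕ, N₀ ≤ N → varR N ≤ 4) {f : ℕ → ℝ}
    (hlow : ∀ᶠ N in atTop, (runThreshold N : ℝ) * prR N (runThreshold N) ≤ f N)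
    (hup : ∀ N, f N ≤ meanR N) :
    Tendsto (fun N : ℕ => f N / Real.logb 2 N) atTop (𝓝 1) := by
  have hupper : Tendsto (fun N : ℕ => 1 + C / Real.logb 2 N) atTop (𝓝 1) := by
    simpa using (tendsto_logb_natCast_atTop.const_div_atTop C).const_add 1
  refine tendsto_of_tendsto_of_tendsto_of_le_of_le' (tendsto_lower_envelope C) hupper ?_ ?_
  · filter_upwards [le_runThreshold_mul_prR_div hE hV, hlow,
      tendsto_logb_natCast_atTop.eventually_gt_atTop 0] with N h₁ h₂ hL
    exact h₁.trans (by gcongr)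
  · filter_upwards [eventually_ge_atTop N₀,
      tendsto_logb_natCast_atTop.eventually_gt_atTop 0] with N hN hL
    rw [div_le_iff₀ hL, add_mul, div_mul_cancel₀ _ hL.ne', one_mul]
    linarith [(abs_le.1 (hE N hN)).2, hup N]

/-- Assuming `|E(R_N) - log₂ N| ≤ C` and `Var(R_N) ≤ 4` for all large `N`, we have
`liminf_N (max_{1 ≤ k ≤ N} k · P(R_N ≥ k)) / log₂ N ≥ 1`; in particular there are
stopping times `τ_N` on `{0,1}^N` whose normalized expected payoffs
`E[1_{τ_N ≤ N} G_{τ_N}] / log₂ N` have liminf at least 1. -/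
theorem liminf_best_threshold_payoff (C : ℝ) (hC : 0 < C) (N₀ : ℕ)
    (hE : ∀ N : ℕ, N₀ ≤ N → |meanR N - Real.logb 2 N| ≤ C)
    (hV : ∀ N : ℕ, N₀ ≤ N → varR N ≤ 4) :
    (1 : ℝ) ≤ Filter.liminf
        (fun N : ℕ =>
          (⨆ k ∈ Finset.Icc 1 N, (k : ℝ) * prR N k) / Real.logb 2 N)
        Filter.atTop ∧
      ∃ τ : (N : ℕ) → (Fin N → Bool) → ℕ∞,
        (∀ N n : ℕ, MeasurableSet[coordFiltration N n] {ω | τ N ω ≤ (n : ℕ∞)}) ∧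
        (1 : ℝ) ≤ Filter.liminf
          (fun N : ℕ =>
            ((∑ ω : Fin N → Bool,
                if τ N ω ≤ (N : ℕ∞) then (runG N ω ((τ N ω).toNat) : ℝ) else 0)
              / 2 ^ N) / Real.logb 2 N)
          Filter.atTop := by
  refine ⟨(tendsto_div_logb_of_le_meanR hE hV ?_ iSup_mul_prR_le_meanR).liminf_eq.ge,
    fun N => firstRun (runThreshold N) N,
    fun N n => measurableSet_firstRun_le _ N n,
    (tendsto_div_logb_of_le_meanR hE hV ?_ fun N => payoff_le_meanR N _).liminf_eq.ge⟩
  · filter_upwards [runThreshold_mem_Icc] with N hN using mul_prR_le_iSup hN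
  · exact Eventually.of_forall fun N => mul_prR_le_firstRun_payoff N _
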